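/- Let Ω ⊂ ℝ² be a Jordan domain with analytic boundary, let f⁰ be a harmonic function in Ω that extends to a real analytic function in the closed domain Ω̄ and whose Hessian matrix is nonzero at every point of Ω̄, and let ε > 0. Then there is at most one function f : Ω̄ × [−ε, ε] → ℝ real analytic in the closed domain such that f(·,·,t) satisfies the isotropic CRPC equation f_xx + f_yy = t·√(f_xy² − f_xx·f_yy) on Ω for each t ∈ [−ε, ε], and f(x,y,t) = f⁰(x,y) whenever t = 0 or (x,y) ∈ ∂Ω. -/

import Mathlib

open Set Filter
open scoped BigOperators Topology

noncomputable section

/-- Partial derivative in the first variable. -/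
def pdx (f : ℝ × ℝ → ℝ) (p : ℝ × ℝ) : ℝ := deriv (fun s : ℝ => f (s, p.2)) p.1

/-- Partial derivative in the second variable. -/
def pdy (f : ℝ × ℝ → ℝ) (p : ℝ × ℝ) : ℝ := deriv (fun s : ℝ => f (p.1, s)) p.2

/-- Second partial derivatives. -/
def fxx (f : ℝ × ℝ → ℝ) : ℝ × ℝ → ℝ := pdx (pdx f)
def fxy (f : ℝ × ℝ → ℝ) : ℝ × ℝ → ℝ := pdy (pdx f)
def fyy (f : ℝ × ℝ → ℝ) : ℝ × ℝ → ℝ := pdy (pdy f)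

/-- An analytic Jordan curve: image of a periodic injective real analytic map with
nowhere vanishing derivative. -/
def IsAnalyticJordanCurve {E : Type*} [NormedAddCommGroup E] [NormedSpace ℝ E]
    (Γ : Set E) : Prop :=
  ∃ (γ : ℝ → E) (T : ℝ), 0 < T ∧
    AnalyticOnNhd ℝ γ univ ∧
    (∀ s, γ (s + T) = γ s) ∧
    InjOn γ (Ico 0 T) ∧
    (∀ s, deriv γ s ≠ 0) ∧
    Γ = range γ

/-- A Jordan domain with analytic boundary. -/
def IsAnalyticJordanDomain (Ω : Set (ℝ × ℝ)) : Prop :=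
  IsOpen Ω ∧ Bornology.IsBounded Ω ∧ IsConnected Ω ∧ IsAnalyticJordanCurve (frontier Ω)

/-- `f` is real analytic in the closed set `s` : it agrees on `s` with a function
analytic on an open neighborhood of `s`. -/
def AnalyticOnClosed {E : Type*} [NormedAddCommGroup E] [NormedSpace ℝ E]
    (f : E → ℝ) (s : Set E) : Prop :=
  ∃ (U : Set E) (g : E → ℝ), IsOpen U ∧ s ⊆ U ∧ AnalyticOnNhd ℝ g U ∧ EqOn f g s

/-- The isotropic CRPC equation with parameter `t` at a point. -/
def IsotropicCRPCAt (t : ℝ) (f : ℝ × ℝ → ℝ) (p : ℝ × ℝ) : Prop :=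
  fxx f p + fyy f p = t * Real.sqrt ((fxy f p) ^ 2 - fxx f p * fyy f p)

/-- The Euclidean CRPC equation with parameter `t` at a point. -/
def EuclideanCRPCAt (t : ℝ) (f : ℝ × ℝ → ℝ) (p : ℝ × ℝ) : Prop :=
  (1 + (pdy f p) ^ 2) * fxx f p - 2 * pdx f p * pdy f p * fxy f p
      + (1 + (pdx f p) ^ 2) * fyy f p
    = t * Real.sqrt ((1 + (pdx f p) ^ 2 + (pdy f p) ^ 2)
        * ((fxy f p) ^ 2 - fxx f p * fyy f p))

/-- Hölder condition with exponent 1/2 on a set. -/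
def HolderHalfOn (g : ℝ × ℝ → ℝ) (s : Set (ℝ × ℝ)) : Prop :=
  ∃ C : ℝ, ∀ u ∈ s, ∀ v ∈ s, |g u - g v| ≤ C * ‖u - v‖ ^ ((1 : ℝ) / 2)

def C0norm (g : ℝ × ℝ → ℝ) (s : Set (ℝ × ℝ)) : ℝ := sSup ((fun p => |g p|) '' s)

def holderSemi (g : ℝ × ℝ → ℝ) (s : Set (ℝ × ℝ)) : ℝ :=
  sSup {r : ℝ | ∃ u ∈ s, ∃ v ∈ s, u ≠ v ∧ r = |g u - g v| / ‖u - v‖ ^ ((1 : ℝ) / 2)}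

/-- The `C^{1/2}` Hölder norm. -/
def ChalfNorm (g : ℝ × ℝ → ℝ) (s : Set (ℝ × ℝ)) : ℝ := C0norm g s + holderSemi g s

/-- The `C²` norm. -/
def C2norm (f : ℝ × ℝ → ℝ) (s : Set (ℝ × ℝ)) : ℝ :=
  C0norm f s + max (C0norm (pdx f) s) (C0norm (pdy f) s)
    + max (C0norm (fxx f) s) (max (C0norm (fxy f) s) (C0norm (fyy f) s))

/-- The `C^{2+1/2}` Hölder norm. -/
def C2halfNorm (f : ℝ × ℝ → ℝ) (s : Set (ℝ × ℝ)) : ℝ :=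
  C2norm f s + max (holderSemi (fxx f) s) (max (holderSemi (fxy f) s) (holderSemi (fyy f) s))

/-- Membership in the class `C^{1/2}` on `Ω̄`. -/
def IsCHalf (g : ℝ × ℝ → ℝ) (Ω : Set (ℝ × ℝ)) : Prop :=
  ContinuousOn g (closure Ω) ∧ HolderHalfOn g Ω

/-- Membership in the class `C^{2+1/2}` on `Ω̄`. -/
def IsC2Half (f : ℝ × ℝ → ℝ) (Ω : Set (ℝ × ℝ)) : Prop :=
  ContDiffOn ℝ 2 f Ω ∧
  ContinuousOn f (closure Ω) ∧ ContinuousOn (pdx f) (closure Ω) ∧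
  ContinuousOn (pdy f) (closure Ω) ∧ ContinuousOn (fxx f) (closure Ω) ∧
  ContinuousOn (fxy f) (closure Ω) ∧ ContinuousOn (fyy f) (closure Ω) ∧
  HolderHalfOn (fxx f) Ω ∧ HolderHalfOn (fxy f) Ω ∧ HolderHalfOn (fyy f) Ω

/-- `C^∞` up to the boundary. -/
def IsCInftyClosed (f : ℝ × ℝ → ℝ) (Ω : Set (ℝ × ℝ)) : Prop :=
  ContDiffOn ℝ (⊤ : ℕ∞) f Ω ∧ ∀ i j : ℕ, ContinuousOn (pdx^[i] (pdy^[j] f)) (closure Ω)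

/-- Right-hand side of the recursive Poisson equation (isotropic case). -/
def poissonRHS (f : ℕ → ℝ × ℝ → ℝ) (m : ℕ) (p : ℝ × ℝ) : ℝ :=
  ((m : ℝ) * ∑ r ∈ Finset.range m, ((m - 1).choose r : ℝ) *
      (fxy (f r) p * fxy (f (m - r - 1)) p - fxx (f r) p * fyy (f (m - r - 1)) p)
    - (1 / ((m : ℝ) + 1)) * ∑ r ∈ Finset.Icc 2 (m - 1), ((m + 1).choose r : ℝ) *
      (fxx (f r) p + fyy (f r) p) * (fxx (f (m - r + 1)) p + fyy (f (m - r + 1)) p))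
  / ((2 : ℝ) ^ (1 - (if m = 1 then 1 else 0) : ℕ) *
      Real.sqrt ((fxy (f 0) p) ^ 2 - fxx (f 0) p * fyy (f 0) p))

/-- `C²`-convergence on `Ω` at parameter `t` of the series with terms `f m · t^m/m!`
to the function `F`. -/
def C2ConvergesTo (f : ℕ → ℝ × ℝ → ℝ) (Ω : Set (ℝ × ℝ)) (t : ℝ) (F : ℝ × ℝ → ℝ) : Prop :=
  TendstoUniformlyOn
    (fun n p => ∑ m ∈ Finset.range n, f m p * t ^ m / (m.factorial : ℝ)) F atTop Ω ∧
  TendstoUniformlyOn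
    (fun n p => ∑ m ∈ Finset.range n, pdx (f m) p * t ^ m / (m.factorial : ℝ)) (pdx F) atTop Ω ∧
  TendstoUniformlyOn
    (fun n p => ∑ m ∈ Finset.range n, pdy (f m) p * t ^ m / (m.factorial : ℝ)) (pdy F) atTop Ω ∧
  TendstoUniformlyOn
    (fun n p => ∑ m ∈ Finset.range n, fxx (f m) p * t ^ m / (m.factorial : ℝ)) (fxx F) atTop Ω ∧
  TendstoUniformlyOn
    (fun n p => ∑ m ∈ Finset.range n, fxy (f m) p * t ^ m / (m.factorial : ℝ)) (fxy F) atTop Ω ∧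
  TendstoUniformlyOn
    (fun n p => ∑ m ∈ Finset.range n, fyy (f m) p * t ^ m / (m.factorial : ℝ)) (fyy F) atTop Ω


/-- `F` is a real analytic family of functions on `Ω̄ × [-ε, ε]`, coinciding with `f0`
for `t = 0` and on `∂Ω`, whose slice at parameter `t` satisfies the isotropic CRPC
equation with parameter `t` on `Ω`. -/
def IsIsotropicCRPCFamily (Ω : Set (ℝ × ℝ)) (f0 : ℝ × ℝ → ℝ) (ε : ℝ)
    (F : (ℝ × ℝ) × ℝ → ℝ) : Prop :=
  AnalyticOnClosed F (closure Ω ×ˢ Icc (-ε) ε) ∧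
  (∀ p ∈ closure Ω, F (p, 0) = f0 p) ∧
  (∀ p ∈ frontier Ω, ∀ t ∈ Icc (-ε) ε, F (p, t) = f0 p) ∧
  (∀ t ∈ Icc (-ε) ε, ∀ p ∈ Ω, IsotropicCRPCAt t (fun q => F (q, t)) p)

theorem crpc_sq (t a b c : ℝ) (h : a + c = t * Real.sqrt (b ^ 2 - a * c)) :
    (Real.sqrt (b ^ 2 - a * c)) ^ 2 = b ^ 2 - a * c := by
  apply Real.sq_sqrt
  by_contra hn
  push Not at hn
  rw [Real.sqrt_eq_zero_of_nonpos hn.le] at h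
  have : c = -a := by linarith
  subst this
  nlinarith [sq_nonneg a, sq_nonneg b]

set_option maxHeartbeats 1600000 in
theorem crpc_alg (t a b c a' b' c' δ : ℝ) (hδ : 0 < δ)
    (h : a + c = t * Real.sqrt (b ^ 2 - a * c))
    (h' : a' + c' = t * Real.sqrt (b' ^ 2 - a' * c'))
    (hq : ∀ e1 e2 : ℝ, (e1 ^ 2 * a + 2 * e1 * e2 * b + e2 ^ 2 * c)
      - (e1 ^ 2 * a' + 2 * e1 * e2 * b' + e2 ^ 2 * c') + 2 * δ * (e1 ^ 2 + e2 ^ 2) ≤ 0) :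
    False := by
  have hS := crpc_sq t a b c h
  have hS' := crpc_sq t a' b' c' h'
  have h0 := Real.sqrt_nonneg (b ^ 2 - a * c)
  have h0' := Real.sqrt_nonneg (b' ^ 2 - a' * c')
  set S := Real.sqrt (b ^ 2 - a * c)
  set S' := Real.sqrt (b' ^ 2 - a' * c')
  have e1 : (a - c) ^ 2 + 4 * b ^ 2 = (4 + t ^ 2) * S ^ 2 := by
    have : (a + c) ^ 2 = t ^ 2 * S ^ 2 := by rw [h]; ring
    nlinarith
  have e2 : (a' - c') ^ 2 + 4 * b' ^ 2 = (4 + t ^ 2) * S' ^ 2 := by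
    have : (a' + c') ^ 2 = t ^ 2 * S' ^ 2 := by rw [h']; ring
    nlinarith
  have cs : (a - c) * (a' - c') + 4 * b * b' ≤ (4 + t ^ 2) * (S * S') := by
    refine le_trans (le_abs_self _) (abs_le_of_sq_le_sq ?_ ?_)
    · have : ((4 + t ^ 2) * (S * S')) ^ 2
          = ((a - c) ^ 2 + 4 * b ^ 2) * ((a' - c') ^ 2 + 4 * b' ^ 2) := by
        rw [e1, e2]; ring
      rw [this]
      nlinarith [sq_nonneg ((a - c) * b' - (a' - c') * b)]
    · positivity
  have hX := hq 1 0
  have hZ := hq 0 1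
  set X := a - a' + 2 * δ with hXd
  set Z := c - c' + 2 * δ with hZd
  set Y := b - b' with hYd
  have hX0 : X ≤ 0 := by linarith
  have hZ0 : Z ≤ 0 := by linarith
  have hq' : ∀ e1 e2 : ℝ, e1 ^ 2 * X + 2 * e1 * e2 * Y + e2 ^ 2 * Z ≤ 0 := by
    intro u v
    have := hq u v
    rw [hXd, hYd, hZd]
    linarith
  have hdet : Y ^ 2 ≤ X * Z := by
    rcases hX0.eq_or_lt with hx | hx
    · have h1 := hq' (Y * (1 - Z)) (Y ^ 2)
      rw [hx] at h1 ⊢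
      by_contra hc
      have hY : 0 < Y ^ 2 := by linarith
      have hY4 : 0 < Y ^ 2 * Y ^ 2 := by positivity
      nlinarith
    · have h1 := hq' Y (-X)
      by_contra hc
      push Not at hc
      nlinarith
  have hlast : (a - a' + (c - c')) ^ 2
      ≤ (a - a' - (c - c')) ^ 2 + 4 * (b - b') ^ 2 := by
    have k1 : (a - a' + (c - c')) ^ 2 = t ^ 2 * (S - S') ^ 2 := by
      have : a - a' + (c - c') = t * (S - S') := by linarith
      rw [this]; ring
    rw [k1]
    nlinarith [sq_nonneg (S - S')]
  have hXa : a - a' = X - 2 * δ := by rw [hXd]; ring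
  have hZa : c - c' = Z - 2 * δ := by rw [hZd]; ring
  rw [hXa, hZa, ← hYd] at hlast
  nlinarith [mul_nonneg hδ.le (neg_nonneg.2 hX0), mul_nonneg hδ.le (neg_nonneg.2 hZ0), mul_pos hδ hδ]

theorem crpc_dir (u : ℝ × ℝ → ℝ) (p : ℝ × ℝ) (hu : ContDiffAt ℝ 2 u p) (e1 e2 : ℝ) :
    ∃ h1 : ℝ → ℝ, (∀ᶠ r in 𝓝 (0 : ℝ),
        HasDerivAt (fun r : ℝ => u (p.1 + r * e1, p.2 + r * e2)) (h1 r) r) ∧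
      HasDerivAt h1 (e1 ^ 2 * fxx u p + 2 * e1 * e2 * fxy u p + e2 ^ 2 * fyy u p) 0 := by
  have hd : ∀ᶠ q in 𝓝 p, DifferentiableAt ℝ u q := by
    have := hu.eventually (by simp)
    filter_upwards [this] with q hq using hq.differentiableAt (by norm_num)
  have hd2 : DifferentiableAt ℝ (fderiv ℝ u) p :=
    (hu.fderiv_right (m := 1) (by norm_num)).differentiableAt (by norm_num)
  have hsym : ∀ v w, fderiv ℝ (fderiv ℝ u) p v w = fderiv ℝ (fderiv ℝ u) p w v := by
    intro v w
    exact (hu.isSymmSndFDerivAt (by simp)).eq v w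
  have lx : ∀ q : ℝ × ℝ, HasDerivAt (fun s : ℝ => ((s, q.2) : ℝ × ℝ)) (1, 0) q.1 := fun q =>
    (hasDerivAt_id q.1).prodMk (hasDerivAt_const q.1 q.2)
  have ly : ∀ q : ℝ × ℝ, HasDerivAt (fun s : ℝ => ((q.1, s) : ℝ × ℝ)) (0, 1) q.2 := fun q =>
    (hasDerivAt_const q.2 q.1).prodMk (hasDerivAt_id q.2)
  have gx : ∀ (w : ℝ × ℝ → ℝ) (q : ℝ × ℝ), DifferentiableAt ℝ w q →
      pdx w q = fderiv ℝ w q (1, 0) := fun w q hw =>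
    (HasFDerivAt.comp_hasDerivAt (f := fun s : ℝ => ((s, q.2) : ℝ × ℝ)) q.1
      hw.hasFDerivAt (lx q)).deriv
  have gy : ∀ (w : ℝ × ℝ → ℝ) (q : ℝ × ℝ), DifferentiableAt ℝ w q →
      pdy w q = fderiv ℝ w q (0, 1) := fun w q hw =>
    (HasFDerivAt.comp_hasDerivAt (f := fun s : ℝ => ((q.1, s) : ℝ × ℝ)) q.2
      hw.hasFDerivAt (ly q)).deriv
  have ex : pdx u =ᶠ[𝓝 p] fun q => fderiv ℝ u q (1, 0) := by
    filter_upwards [hd] with q hq using gx u q hq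
  have ey : pdy u =ᶠ[𝓝 p] fun q => fderiv ℝ u q (0, 1) := by
    filter_upwards [hd] with q hq using gy u q hq
  have fd : ∀ v : ℝ × ℝ, HasFDerivAt (fun q => fderiv ℝ u q v)
      ((fderiv ℝ (fderiv ℝ u) p).flip v) p := by
    intro v
    have := hd2.hasFDerivAt.clm_apply (hasFDerivAt_const v p)
    simpa using this
  have fdx := (fd (1, 0)).congr_of_eventuallyEq ex
  have fdy := (fd (0, 1)).congr_of_eventuallyEq ey
  have vxx : fxx u p = fderiv ℝ (fderiv ℝ u) p (1, 0) (1, 0) := by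
    rw [fxx, gx _ _ fdx.differentiableAt, fdx.fderiv]; rfl
  have vxy : fxy u p = fderiv ℝ (fderiv ℝ u) p (0, 1) (1, 0) := by
    rw [fxy, gy _ _ fdx.differentiableAt, fdx.fderiv]; rfl
  have vyy : fyy u p = fderiv ℝ (fderiv ℝ u) p (0, 1) (0, 1) := by
    rw [fyy, gy _ _ fdy.differentiableAt, fdy.fderiv]; rfl
  have ll : ∀ r : ℝ, HasDerivAt (fun r : ℝ => ((p.1 + r * e1, p.2 + r * e2) : ℝ × ℝ))
      (e1, e2) r := by
    intro r
    have a1 : HasDerivAt (fun r : ℝ => p.1 + r * e1) e1 r := by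
      simpa using ((hasDerivAt_id r).mul_const e1).const_add p.1
    have a2 : HasDerivAt (fun r : ℝ => p.2 + r * e2) e2 r := by
      simpa using ((hasDerivAt_id r).mul_const e2).const_add p.2
    exact a1.prodMk a2
  have l0 : ((p.1 + 0 * e1, p.2 + 0 * e2) : ℝ × ℝ) = p := by simp
  refine ⟨fun r => fderiv ℝ u (p.1 + r * e1, p.2 + r * e2) (e1, e2), ?_, ?_⟩
  · have ht : Tendsto (fun r : ℝ => ((p.1 + r * e1, p.2 + r * e2) : ℝ × ℝ)) (𝓝 0) (𝓝 p) := by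
      have := (ll 0).continuousAt.tendsto
      rwa [l0] at this
    filter_upwards [ht.eventually hd] with r hr
    exact HasFDerivAt.comp_hasDerivAt (f := fun r : ℝ => ((p.1 + r * e1, p.2 + r * e2) : ℝ × ℝ)) r
      hr.hasFDerivAt (ll r)
  · have key : HasFDerivAt (fun q => fderiv ℝ u q (e1, e2))
      ((fderiv ℝ (fderiv ℝ u) p).flip (e1, e2)) (p.1 + 0 * e1, p.2 + 0 * e2) := by
      rw [l0]; exact fd _
    have := HasFDerivAt.comp_hasDerivAt
      (f := fun r : ℝ => ((p.1 + r * e1, p.2 + r * e2) : ℝ × ℝ)) 0 key (ll 0)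
    refine this.congr_deriv ?_
    rw [vxx, vxy, vyy]
    have ee : ((e1, e2) : ℝ × ℝ) = e1 • (1, 0) + e2 • (0, 1) := by simp
    rw [ContinuousLinearMap.flip_apply, ee]
    simp only [map_add, map_smul, ContinuousLinearMap.add_apply, ContinuousLinearMap.smul_apply,
      smul_eq_mul]
    rw [hsym (1, 0) (0, 1)]
    ring

theorem crpc_snd (h h1 : ℝ → ℝ) (d : ℝ) (hm : IsLocalMax h 0)
    (hh : ∀ᶠ r in 𝓝 (0 : ℝ), HasDerivAt h (h1 r) r) (hd : HasDerivAt h1 d 0) : d ≤ 0 := by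
  by_contra hc
  push Not at hc
  have e : deriv h =ᶠ[𝓝 0] h1 := by
    filter_upwards [hh] with r hr using hr.deriv
  have hdd : deriv (deriv h) 0 = d := by rw [e.deriv_eq, hd.deriv]
  have hmin : IsLocalMin h 0 :=
    isLocalMin_of_deriv_deriv_pos (by rw [hdd]; exact hc) hm.deriv_eq_zero
      hh.self_of_nhds.continuousAt
  have hconst : h =ᶠ[𝓝 0] fun _ => h 0 := by
    filter_upwards [hm, hmin] with r h1 h2 using le_antisymm h1 h2
  have := hconst.deriv.deriv_eq
  rw [hdd] at this
  simp at this
  linarith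

theorem crpc_le (Ω : Set (ℝ × ℝ)) (ho : IsOpen Ω) (hb : Bornology.IsBounded Ω)
    (t : ℝ) (u v : ℝ × ℝ → ℝ)
    (hu : ∀ p ∈ Ω, ContDiffAt ℝ 2 u p) (hv : ∀ p ∈ Ω, ContDiffAt ℝ 2 v p)
    (hcu : ContinuousOn u (closure Ω)) (hcv : ContinuousOn v (closure Ω))
    (hfr : ∀ p ∈ frontier Ω, u p = v p)
    (eu : ∀ p ∈ Ω, IsotropicCRPCAt t u p) (ev : ∀ p ∈ Ω, IsotropicCRPCAt t v p) :
    ∀ p ∈ closure Ω, u p ≤ v p := by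
  intro p0 hp0
  by_contra hc
  push Not at hc
  have hK : IsCompact (closure Ω) := hb.isCompact_closure
  have hcq : Continuous fun q : ℝ × ℝ => q.1 ^ 2 + q.2 ^ 2 := by fun_prop
  obtain ⟨R, hR⟩ := hK.exists_bound_of_continuousOn hcq.continuousOn
  have hR0 : 0 ≤ R := (norm_nonneg _).trans (hR p0 hp0)
  set m := u p0 - v p0 with hmd
  have hm : 0 < m := by linarith
  obtain ⟨δ, hδ, hδR⟩ : ∃ δ : ℝ, 0 < δ ∧ δ * R < m := by
    refine ⟨m / (R + 1), by positivity, ?_⟩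
    rw [div_mul_eq_mul_div, div_lt_iff₀ (by positivity)]
    nlinarith
  obtain ⟨p, hp, hpm⟩ := hK.exists_isMaxOn ⟨p0, hp0⟩
    ((hcu.sub hcv).add (hcq.continuousOn.const_smul δ))
  have hpm' : ∀ q ∈ closure Ω, u q - v q + δ * (q.1 ^ 2 + q.2 ^ 2)
      ≤ u p - v p + δ * (p.1 ^ 2 + p.2 ^ 2) := fun q hq => hpm hq
  have hpΩ : p ∈ Ω := by
    by_contra hn
    have hf : p ∈ frontier Ω := by
      rw [ho.frontier_eq]; exact ⟨hp, hn⟩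
    have h1 := hpm' p0 hp0
    rw [hfr p hf] at h1
    have h2 := (Real.norm_eq_abs _ ▸ le_abs_self _).trans (hR p hp)
    have h3 : 0 ≤ δ * (p0.1 ^ 2 + p0.2 ^ 2) := by positivity
    have h4 := mul_le_mul_of_nonneg_left h2 hδ.le
    linarith
  refine crpc_alg t _ _ _ _ _ _ δ hδ (eu p hpΩ) (ev p hpΩ) fun e1 e2 => ?_
  obtain ⟨a1, ha, ha'⟩ := crpc_dir u p (hu p hpΩ) e1 e2
  obtain ⟨b1, hb1, hb'⟩ := crpc_dir v p (hv p hpΩ) e1 e2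
  have hline : Continuous fun r : ℝ => ((p.1 + r * e1, p.2 + r * e2) : ℝ × ℝ) := by fun_prop
  have hq1 : ∀ r : ℝ, HasDerivAt
      (fun r : ℝ => δ * ((p.1 + r * e1) ^ 2 + (p.2 + r * e2) ^ 2))
      (2 * δ * ((p.1 * e1 + p.2 * e2) + r * (e1 ^ 2 + e2 ^ 2))) r := by
    intro r
    have a1 : HasDerivAt (fun r : ℝ => p.1 + r * e1) e1 r := by
      simpa using ((hasDerivAt_id r).mul_const e1).const_add p.1
    have a2 : HasDerivAt (fun r : ℝ => p.2 + r * e2) e2 r := by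
      simpa using ((hasDerivAt_id r).mul_const e2).const_add p.2
    refine (((a1.pow 2).add (a2.pow 2)).const_mul δ).congr_deriv ?_
    norm_num
    ring
  have hq2 : HasDerivAt
      (fun r : ℝ => 2 * δ * ((p.1 * e1 + p.2 * e2) + r * (e1 ^ 2 + e2 ^ 2)))
      (2 * δ * (e1 ^ 2 + e2 ^ 2)) 0 := by
    simpa using (((hasDerivAt_id (0 : ℝ)).mul_const (e1 ^ 2 + e2 ^ 2)).const_add
      (p.1 * e1 + p.2 * e2)).const_mul (2 * δ)
  refine crpc_snd
    (fun r => u (p.1 + r * e1, p.2 + r * e2) - v (p.1 + r * e1, p.2 + r * e2)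
      + δ * ((p.1 + r * e1) ^ 2 + (p.2 + r * e2) ^ 2))
    (fun r => a1 r - b1 r + 2 * δ * ((p.1 * e1 + p.2 * e2) + r * (e1 ^ 2 + e2 ^ 2)))
    _ ?_ ?_ ((ha'.sub hb').add hq2)
  · have hev : ∀ᶠ r in 𝓝 (0 : ℝ), ((p.1 + r * e1, p.2 + r * e2) : ℝ × ℝ) ∈ Ω := by
      refine hline.continuousAt.eventually_mem (ho.mem_nhds ?_)
      simpa using hpΩ
    filter_upwards [hev] with r hr
    simpa using hpm' _ (subset_closure hr)
  · filter_upwards [ha, hb1] with r h1 h2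
    exact (h1.sub h2).add (hq1 r)

theorem crpc_reg (Ω : Set (ℝ × ℝ)) (ho : IsOpen Ω) (ε : ℝ) (F : (ℝ × ℝ) × ℝ → ℝ)
    (hF : AnalyticOnClosed F (closure Ω ×ˢ Icc (-ε) ε)) (t : ℝ) (ht : t ∈ Icc (-ε) ε) :
    (∀ p ∈ Ω, ContDiffAt ℝ 2 (fun q => F (q, t)) p) ∧
      ContinuousOn (fun q => F (q, t)) (closure Ω) := by
  obtain ⟨U, g, hU, hs, hg, he⟩ := hF
  have hga : ∀ p ∈ closure Ω, ContDiffAt ℝ 2 (fun q => g (q, t)) p := by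
    intro p hp
    have h1 : ContDiffAt ℝ 2 g (p, t) := (hg (p, t) (hs ⟨hp, ht⟩)).contDiffAt
    exact h1.comp p (contDiffAt_id.prodMk contDiffAt_const)
  have hee : EqOn (fun q => F (q, t)) (fun q => g (q, t)) (closure Ω) :=
    fun q hq => he ⟨hq, ht⟩
  refine ⟨fun p hp => (hga p (subset_closure hp)).congr_of_eventuallyEq ?_, ?_⟩
  · filter_upwards [ho.mem_nhds hp] with q hq using hee (subset_closure hq)
  · exact ContinuousOn.congr (fun p hp => (hga p hp).continuousAt.continuousWithinAt) hee

/-- Uniqueness of a real analytic family of solutions of the isotropic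
CRPC equations containing a given harmonic function and having fixed boundary values. -/
theorem stmt_6 (Ω : Set (ℝ × ℝ)) (hΩ : IsAnalyticJordanDomain Ω)
    (f0 : ℝ × ℝ → ℝ) (hf0 : AnalyticOnClosed f0 (closure Ω))
    (hharm : ∀ p ∈ Ω, fxx f0 p + fyy f0 p = 0)
    (hhess : ∀ p ∈ closure Ω, ¬(fxx f0 p = 0 ∧ fxy f0 p = 0 ∧ fyy f0 p = 0))
    (ε : ℝ) (hε : 0 < ε) :
    ∀ F G : (ℝ × ℝ) × ℝ → ℝ,
      IsIsotropicCRPCFamily Ω f0 ε F → IsIsotropicCRPCFamily Ω f0 ε G →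
      ∀ p ∈ closure Ω, ∀ t ∈ Icc (-ε) ε, F (p, t) = G (p, t) := by
  intro F G hF hG p hp t ht
  obtain ⟨ho, hb, -, -⟩ := hΩ
  obtain ⟨rF, cF⟩ := crpc_reg Ω ho ε F hF.1 t ht
  obtain ⟨rG, cG⟩ := crpc_reg Ω ho ε G hG.1 t ht
  have hfr : ∀ q ∈ frontier Ω, F (q, t) = G (q, t) := fun q hq => by
    rw [hF.2.2.1 q hq t ht, hG.2.2.1 q hq t ht]
  exact le_antisymm
    (crpc_le Ω ho hb t _ _ rF rG cF cG hfr (hF.2.2.2 t ht) (hG.2.2.2 t ht) p hp)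
    (crpc_le Ω ho hb t _ _ rG rF cG cF (fun q hq => (hfr q hq).symm)
      (hG.2.2.2 t ht) (hF.2.2.2 t ht) p hp)

end
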